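/- arXiv:2007.06479 — 2 statements merged into one kernel-verified Lean document; each statement's English description precedes it below -/
import Mathlib

section
/- On ℝⁿ with the Euclidean norm, let T_i : ℝⁿ → ℝⁿ be nonexpansive for all i ∈ I, and suppose the Markov operator 𝒫 possesses at least one invariant probability measure. Then for every probability measure μ on ℝⁿ, the sequence (μ𝒫ᵏ)_{k∈ℕ} of distributions of the RFI iterates is tight. -/
open MeasureTheory Filter Topology

/-- One application of the dual Markov operator of the RFI, with `μξ` the law of `ξ`. -/
noncomputable def markovStep {G I : Type*} [MeasurableSpace G] [MeasurableSpace I]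
    (μξ : MeasureTheory.Measure I) (T : I → G → G) (μ : MeasureTheory.Measure G) :
    MeasureTheory.Measure G :=
  μ.bind fun x => μξ.map fun i => T i x

section MarkovStep

variable {G H I : Type*} [MeasurableSpace G] [MeasurableSpace H] [MeasurableSpace I]
  {μξ : Measure I}

/-- One Markov step is the law of `T ξ X` for independent `X ∼ μ` and `ξ ∼ μξ`. -/
theorem markovStep_eq_map_prod [SFinite μξ] {T : I → G → G}
    (hT : Measurable fun p : G × I => T p.2 p.1) (μ : Measure G) :
    markovStep μξ T μ = (μ.prod μξ).map fun p => T p.2 p.1 := by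
  have hκ : (fun x => μξ.map fun i => T i x) =
      fun x => (μξ.map (Prod.mk x)).map fun p : G × I => T p.2 p.1 := by
    funext x
    rw [Measure.map_map hT measurable_prodMk_left]
    rfl
  have hm : Measurable fun x : G => μξ.map (Prod.mk x : I → G × I) :=
    Measurable.map_prodMk_left
  have hm' : Measurable fun x => (μξ.map (Prod.mk x)).map fun p : G × I => T p.2 p.1 :=
    (Measure.measurable_map _ hT).comp hm
  ext s hs
  rw [markovStep, hκ, Measure.bind_apply hs hm'.aemeasurable, Measure.map_apply hT hs,
    Measure.prod_apply (hT hs)]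
  refine lintegral_congr fun x => ?_
  rw [Measure.map_apply hT hs, Measure.map_apply measurable_prodMk_left (hT hs)]

theorem isProbabilityMeasure_markovStep [IsProbabilityMeasure μξ] {T : I → G → G}
    (hT : Measurable fun p : G × I => T p.2 p.1) (μ : Measure G) [IsProbabilityMeasure μ] :
    IsProbabilityMeasure (markovStep μξ T μ) := by
  rw [markovStep_eq_map_prod hT]
  exact Measure.isProbabilityMeasure_map hT.aemeasurable

theorem isProbabilityMeasure_iterate_markovStep [IsProbabilityMeasure μξ] {T : I → G → G}
    (hT : Measurable fun p : G × I => T p.2 p.1) (μ : Measure G) [IsProbabilityMeasure μ]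
    (k : ℕ) : IsProbabilityMeasure ((markovStep μξ T)^[k] μ) := by
  induction k with
  | zero => simpa
  | succ k ih =>
    rw [Function.iterate_succ_apply']
    exact isProbabilityMeasure_markovStep hT _

/-- A Markov step commutes with pushing forward along a map semiconjugating the updates. -/
theorem map_markovStep_of_semiconj [IsProbabilityMeasure μξ] {S : I → G → G} {T : I → H → H}
    (hS : Measurable fun p : G × I => S p.2 p.1) (hT : Measurable fun p : H × I => T p.2 p.1)
    {f : G → H} (hf : Measurable f) (hsemi : ∀ i, Function.Semiconj f (S i) (T i))
    (μ : Measure G) [IsProbabilityMeasure μ] :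
    (markovStep μξ S μ).map f = markovStep μξ T (μ.map f) := by
  have : IsProbabilityMeasure (μ.map f) := Measure.isProbabilityMeasure_map hf.aemeasurable
  have hprod := Measure.map_prod_map μ μξ hf measurable_id
  rw [Measure.map_id] at hprod
  rw [markovStep_eq_map_prod hS, markovStep_eq_map_prod hT, hprod, Measure.map_map hf hS,
    Measure.map_map hT (hf.prodMap measurable_id)]
  congr 1
  funext p
  exact hsemi p.2 p.1

theorem map_iterate_markovStep_of_semiconj [IsProbabilityMeasure μξ]
    {S : I → G → G} {T : I → H → H}
    (hS : Measurable fun p : G × I => S p.2 p.1) (hT : Measurable fun p : H × I => T p.2 p.1)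
    {f : G → H} (hf : Measurable f) (hsemi : ∀ i, Function.Semiconj f (S i) (T i))
    (μ : Measure G) [IsProbabilityMeasure μ] (k : ℕ) :
    ((markovStep μξ S)^[k] μ).map f = (markovStep μξ T)^[k] (μ.map f) := by
  induction k with
  | zero => rfl
  | succ k ih =>
    have := isProbabilityMeasure_iterate_markovStep (μξ := μξ) hS μ k
    rw [Function.iterate_succ_apply', Function.iterate_succ_apply',
      map_markovStep_of_semiconj hS hT hf hsemi, ih]

/-- The mass of a set that the updates can only leave, never enter, does not increase. -/
theorem iterate_markovStep_apply_le [IsProbabilityMeasure μξ] {T : I → G → G}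
    (hT : Measurable fun p : G × I => T p.2 p.1) {s : Set G} (hs : MeasurableSet s)
    (hsub : ∀ i, T i ⁻¹' s ⊆ s) (μ : Measure G) (k : ℕ) :
    ((markovStep μξ T)^[k] μ) s ≤ μ s := by
  induction k with
  | zero => rfl
  | succ k ih =>
    rw [Function.iterate_succ_apply', markovStep_eq_map_prod hT, Measure.map_apply hT hs]
    refine le_trans ?_ ih
    calc _ ≤ (((markovStep μξ T)^[k] μ).prod μξ) (s ×ˢ Set.univ) :=
          measure_mono fun p hp => ⟨hsub p.2 hp, trivial⟩
      _ = _ := by simp [Measure.prod_prod]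

end MarkovStep

/-- tightness of `(μ𝒫ᵏ)` in ℝⁿ: each `T i : ℝⁿ → ℝⁿ` nonexpansive and
the Markov operator has an invariant probability measure; then for every probability
measure `μ` on ℝⁿ the sequence of distributions `(μ𝒫ᵏ)` is tight. -/
theorem stmt8
    {n : ℕ} {I : Type*} [MeasurableSpace I]
    (T : I → EuclideanSpace ℝ (Fin n) → EuclideanSpace ℝ (Fin n))
    (hT : ∀ i x y, ‖T i x - T i y‖ ≤ ‖x - y‖)
    (hΦ : Measurable fun p : EuclideanSpace ℝ (Fin n) × I => T p.2 p.1)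
    (μξ : Measure I) [IsProbabilityMeasure μξ]
    (hinv : ∃ π : Measure (EuclideanSpace ℝ (Fin n)),
      IsProbabilityMeasure π ∧ markovStep μξ T π = π)
    (μ : Measure (EuclideanSpace ℝ (Fin n))) [IsProbabilityMeasure μ] :
    ∀ ε : ENNReal, 0 < ε → ∃ K : Set (EuclideanSpace ℝ (Fin n)), IsCompact K ∧
      ∀ k : ℕ, 1 - ε < ((markovStep μξ T)^[k] μ) K := by
  intro ε hε
  obtain ⟨π, hπ, hπT⟩ := hinv
  let E := EuclideanSpace ℝ (Fin n)
  -- The synchronous coupling of the chains started from `μ` and from `π`.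
  let S : I → E × E → E × E := fun i => Prod.map (T i) (T i)
  have hS : Measurable fun p : (E × E) × I => S p.2 p.1 :=
    (hΦ.comp ((measurable_fst.comp measurable_fst).prodMk measurable_snd)).prodMk
      (hΦ.comp ((measurable_snd.comp measurable_fst).prodMk measurable_snd))
  let lam : ℕ → Measure (E × E) := fun k => (markovStep μξ S)^[k] (μ.prod π)
  have hfst (k : ℕ) : (lam k).map Prod.fst = (markovStep μξ T)^[k] μ := by
    rw [map_iterate_markovStep_of_semiconj hS hΦ measurable_fst fun _ _ => rfl]
    simp [Measure.map_fst_prod]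
  have hsnd (k : ℕ) : (lam k).map Prod.snd = π := by
    rw [map_iterate_markovStep_of_semiconj hS hΦ measurable_snd fun _ _ => rfl]
    simpa [Measure.map_snd_prod] using Function.iterate_fixed hπT k
  obtain ⟨δ, hδ, hδε⟩ : ∃ δ : ENNReal, 0 < δ ∧ δ + δ < min ε 1 := by
    have hne : min ε 1 ≠ 0 := (lt_min hε one_pos).ne'
    have htop : min ε 1 ≠ ⊤ := ne_top_of_le_ne_top ENNReal.one_ne_top (min_le_right _ _)
    refine ⟨min ε 1 / 2 / 2, ENNReal.half_pos (ENNReal.half_pos hne).ne', ?_⟩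
    rw [ENNReal.add_halves]
    exact ENNReal.half_lt_self hne htop
  obtain ⟨C, hC, hCδ⟩ := isTightMeasureSet_iff_exists_isCompact_measure_compl_le.1
    (isTightMeasureSet_singleton (μ := μ.prod π)) δ hδ
  replace hCδ := hCδ _ rfl
  obtain ⟨R, hR⟩ := hC.isBounded.exists_norm_le
  have hR1 : ∀ p ∈ C, ‖p.1‖ ≤ R := fun p hp => (norm_fst_le p).trans (hR p hp)
  have hR2 : ∀ p ∈ C, ‖p.2‖ ≤ R := fun p hp => (norm_snd_le p).trans (hR p hp)
  refine ⟨Metric.closedBall 0 (3 * R), isCompact_closedBall _ _, fun k => ?_⟩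
  have hμk := isProbabilityMeasure_iterate_markovStep (μξ := μξ) hΦ μ k
  have hball : MeasurableSet (Metric.closedBall (0 : E) (3 * R)) :=
    Metric.isClosed_closedBall.measurableSet
  let far : Set (E × E) := {p | 2 * R < ‖p.1 - p.2‖}
  have hfar : MeasurableSet far :=
    measurableSet_lt measurable_const (measurable_fst.sub measurable_snd).norm
  let out : Set E := {y | R < ‖y‖}
  have hout : MeasurableSet out := measurableSet_lt measurable_const measurable_norm
  have hfar_le : lam k far ≤ δ := by
    refine (iterate_markovStep_apply_le hS hfar
      (fun i p hp => lt_of_lt_of_le hp (hT i p.1 p.2)) _ k).trans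
      ((measure_mono fun p hp hpC => ?_).trans hCδ)
    have : 2 * R < ‖p.1 - p.2‖ := hp
    linarith [norm_sub_le p.1 p.2, hR1 p hpC, hR2 p hpC]
  have hout_le : lam k (Prod.snd ⁻¹' out) ≤ δ := by
    rw [← Measure.map_apply measurable_snd hout, hsnd k, ← hsnd 0,
      Measure.map_apply measurable_snd hout]
    exact (measure_mono fun p hp hpC => (hR2 p hpC).not_gt hp).trans hCδ
  have hcompl : ((markovStep μξ T)^[k] μ) (Metric.closedBall 0 (3 * R))ᶜ ≤ δ + δ := by
    rw [← hfst k, Measure.map_apply measurable_fst hball.compl]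
    refine ((measure_mono fun p hp => ?_).trans (measure_union_le far (Prod.snd ⁻¹' out))).trans
      (add_le_add hfar_le hout_le)
    by_contra hcon
    simp only [far, out, Set.mem_union, Set.mem_preimage, Set.mem_ofPred_eq, not_or, not_lt]
      at hcon
    refine hp (mem_closedBall_zero_iff.2 ?_)
    linarith [norm_le_norm_sub_add p.1 p.2]
  have hlt := hcompl.trans_lt hδε
  rw [prob_compl_eq_one_sub hball] at hlt
  refine (tsub_le_tsub_left (min_le_left ε 1) 1).trans_lt ?_
  rw [ENNReal.sub_lt_iff_lt_right (by finiteness) prob_le_one] at hlt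
  rw [ENNReal.sub_lt_iff_lt_right (min_lt_of_right_lt ENNReal.one_lt_top).ne
    (min_le_right _ _), add_comm]
  exact hlt
end

section
/- Let G be a Polish space and let T_i : G → G be nonexpansive for all i ∈ I. Let π and π̃ be ergodic invariant probability measures for the Markov operator 𝒫, and let ε ∈ (0,1). Then d_P(π, π̃) ≤ ε if and only if Supp π̃ ⊆ B̄(Supp π, ε), where d_P denotes the Prokhorov–Lévy metric and B̄(S, ε) := {x ∈ G : dist(x, S) ≤ ε}. -/
open MeasureTheory Filter Topology

/-- The support of a measure. -/
def msupport {G : Type*} [TopologicalSpace G] [MeasurableSpace G]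
    (μ : MeasureTheory.Measure G) : Set G :=
  {x | ∀ U ∈ nhds x, 0 < μ U}

/-- `π` is an ergodic invariant probability measure for the RFI Markov operator. -/
def IsErgodicInv {G I : Type*} [MeasurableSpace G] [MeasurableSpace I]
    (μξ : MeasureTheory.Measure I) (T : I → G → G) (π : MeasureTheory.Measure G) : Prop :=
  MeasureTheory.IsProbabilityMeasure π ∧ markovStep μξ T π = π ∧
    ∀ A : Set G, MeasurableSet A →
      (∀ x ∈ A, (μξ.map fun i => T i x) A = 1) → π A = 0 ∨ π A = 1

lemma msupport_eq_support {G : Type*} [TopologicalSpace G] [MeasurableSpace G] (μ : Measure G) :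
    msupport μ = μ.support := by
  ext x
  simp [msupport, Measure.mem_support_iff_forall]

/-- `f` takes values in `[0, 1]` and is `K`-Lipschitz. -/
structure UnitLipschitz {G : Type*} [MetricSpace G] (K : NNReal) (f : G → ℝ) : Prop where
  lip : LipschitzWith K f
  mem_Icc : ∀ x, f x ∈ Set.Icc (0 : ℝ) 1

/-- The Markov operator of the random function iteration, acting on functions. -/
noncomputable def markovFun {G I : Type*} [MeasurableSpace I] (μξ : Measure I) (T : I → G → G)
    (f : G → ℝ) (x : G) : ℝ :=
  ∫ i, f (T i x) ∂μξ

/-- Cesàro averages of the iterates of the Markov operator. -/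
noncomputable def cesaroFun {G I : Type*} [MeasurableSpace I] (μξ : Measure I) (T : I → G → G)
    (f : G → ℝ) (n : ℕ) (x : G) : ℝ :=
  ((n : ℝ) + 1)⁻¹ * ∑ k ∈ Finset.range (n + 1), (markovFun μξ T)^[k] f x

section RandomIteration

variable {G I : Type*} [MetricSpace G] [MeasurableSpace G] [BorelSpace G] [MeasurableSpace I]
  {T : I → G → G} {μξ : Measure I} {μ : Measure G} {K : NNReal} {f g h : G → ℝ}

section UnitLipschitz

omit [MeasurableSpace G] [BorelSpace G] in
lemma UnitLipschitz.norm_le (hf : UnitLipschitz K f) (x : G) : ‖f x‖ ≤ 1 := by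
  rw [Real.norm_eq_abs, abs_of_nonneg (hf.mem_Icc x).1]
  exact (hf.mem_Icc x).2

lemma UnitLipschitz.integrable_comp {α : Type*} [MeasurableSpace α] {ν : Measure α}
    [IsFiniteMeasure ν] (hf : UnitLipschitz K f) {u : α → G} (hu : Measurable u) :
    Integrable (fun a => f (u a)) ν :=
  .of_bound (hf.lip.continuous.measurable.comp hu).aestronglyMeasurable 1
    (ae_of_all _ fun _ => hf.norm_le _)

lemma UnitLipschitz.integrable [IsFiniteMeasure μ] (hf : UnitLipschitz K f) : Integrable f μ :=
  hf.integrable_comp measurable_id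

omit [MeasurableSpace G] [BorelSpace G] in
/-- Uniformly bounded equi-Lipschitz sequences on a separable space have pointwise convergent
subsequences. -/
lemma UnitLipschitz.exists_tendsto_subseq [TopologicalSpace.SeparableSpace G] {F : ℕ → G → ℝ}
    (hF : ∀ n, UnitLipschitz K (F n)) :
    ∃ (φ : ℕ → ℕ) (h : G → ℝ), StrictMono φ ∧ ∀ x, Tendsto (fun n => F (φ n) x) atTop (𝓝 (h x)) := by
  rcases isEmpty_or_nonempty G with hG | hG
  · exact ⟨id, 0, strictMono_id, fun x => hG.elim x⟩
  set d := TopologicalSpace.denseSeq G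
  have hK : IsCompact (Set.pi Set.univ fun _ : ℕ => Set.Icc (0 : ℝ) 1) :=
    isCompact_univ_pi fun _ => isCompact_Icc
  obtain ⟨a, -, φ, hφ, ha⟩ := hK.tendsto_subseq (x := fun n k => F n (d k))
    fun n k _ => (hF n).mem_Icc _
  rw [tendsto_pi_nhds] at ha
  have hc : ∀ x, ∃ l, Tendsto (fun n => F (φ n) x) atTop (𝓝 l) := by
    intro x
    apply cauchySeq_tendsto_of_complete
    rw [Metric.cauchySeq_iff]
    intro η hη
    obtain ⟨k, hk⟩ := (TopologicalSpace.denseRange_denseSeq G).exists_dist_lt x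
      (show 0 < η / (3 * (K + 1)) by positivity)
    obtain ⟨N, hN⟩ := Metric.cauchySeq_iff.1 (ha k).cauchySeq (η / 3) (by positivity)
    refine ⟨N, fun m hm n hn => ?_⟩
    have hx : ∀ j, dist (F j x) (F j (d k)) < η / 3 := by
      intro j
      calc dist (F j x) (F j (d k)) ≤ K * dist x (d k) := (hF j).lip.dist_le_mul _ _
        _ ≤ (K + 1) * dist x (d k) := by gcongr; simp
        _ < (K + 1) * (η / (3 * (K + 1))) := by gcongr
        _ = η / 3 := by field_simp
    have h1 := hx (φ m)
    have h2 := hx (φ n)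
    have h3 : dist (F (φ m) (d k)) (F (φ n) (d k)) < η / 3 := hN m hm n hn
    have h4 := dist_triangle4_right (F (φ m) x) (F (φ n) x) (F (φ m) (d k)) (F (φ n) (d k))
    linarith
  choose h hh using hc
  exact ⟨φ, h, hφ, hh⟩

omit [MeasurableSpace G] [BorelSpace G] in
lemma UnitLipschitz.of_tendsto {F : ℕ → G → ℝ} (hF : ∀ n, UnitLipschitz K (F n))
    (hh : ∀ x, Tendsto (fun n => F n x) atTop (𝓝 (h x))) : UnitLipschitz K h where
  lip := LipschitzWith.of_dist_le_mul fun x y =>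
    le_of_tendsto ((hh x).dist (hh y)) (.of_forall fun n => (hF n).lip.dist_le_mul x y)
  mem_Icc x := isClosed_Icc.mem_of_tendsto (hh x) (.of_forall fun n => (hF n).mem_Icc x)

end UnitLipschitz

omit [BorelSpace G] [MetricSpace G] in
lemma measurable_apply_right (hΦ : Measurable fun p : G × I => T p.2 p.1) (x : G) :
    Measurable fun i => T i x :=
  hΦ.comp measurable_prodMk_left

lemma UnitLipschitz.markovFun [IsProbabilityMeasure μξ] (hf : UnitLipschitz K f)
    (hT : ∀ i x y, dist (T i x) (T i y) ≤ dist x y)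
    (hΦ : Measurable fun p : G × I => T p.2 p.1) : UnitLipschitz K (markovFun μξ T f) where
  lip := by
    refine LipschitzWith.of_dist_le_mul fun x y => ?_
    rw [dist_eq_norm]
    unfold _root_.markovFun
    rw [← integral_sub (hf.integrable_comp (measurable_apply_right hΦ x))
      (hf.integrable_comp (measurable_apply_right hΦ y))]
    refine (norm_integral_le_of_norm_le_const (C := K * dist x y) (ae_of_all _ fun i => ?_)).trans
      (by simp)
    rw [← dist_eq_norm]
    exact (hf.lip.dist_le_mul _ _).trans (by gcongr; exact hT i x y)
  mem_Icc x := by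
    refine ⟨integral_nonneg fun i => (hf.mem_Icc _).1, ?_⟩
    calc ∫ i, f (T i x) ∂μξ ≤ ∫ _, (1 : ℝ) ∂μξ :=
          integral_mono (hf.integrable_comp (measurable_apply_right hΦ x)) (integrable_const _)
            fun i => (hf.mem_Icc _).2
      _ = 1 := by simp

lemma UnitLipschitz.iterate_markovFun [IsProbabilityMeasure μξ] (hf : UnitLipschitz K f)
    (hT : ∀ i x y, dist (T i x) (T i y) ≤ dist x y)
    (hΦ : Measurable fun p : G × I => T p.2 p.1) (k : ℕ) :
    UnitLipschitz K ((_root_.markovFun μξ T)^[k] f) := by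
  induction k with
  | zero => exact hf
  | succ k ih =>
    rw [Function.iterate_succ_apply']
    exact ih.markovFun hT hΦ

lemma UnitLipschitz.cesaroFun [IsProbabilityMeasure μξ] (hf : UnitLipschitz K f)
    (hT : ∀ i x y, dist (T i x) (T i y) ≤ dist x y)
    (hΦ : Measurable fun p : G × I => T p.2 p.1) (n : ℕ) :
    UnitLipschitz K (cesaroFun μξ T f n) where
  lip := by
    refine LipschitzWith.of_dist_le_mul fun x y => ?_
    unfold _root_.cesaroFun
    rw [Real.dist_eq, ← mul_sub, ← Finset.sum_sub_distrib, abs_mul, abs_of_pos (by positivity),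
      inv_mul_le_iff₀ (by positivity)]
    refine (Finset.abs_sum_le_sum_abs _ _).trans ((Finset.sum_le_card_nsmul _ _ (K * dist x y)
      fun k _ => (hf.iterate_markovFun hT hΦ k).lip.dist_le_mul x y).trans ?_)
    simp
  mem_Icc x := by
    unfold _root_.cesaroFun
    refine ⟨mul_nonneg (by positivity) (Finset.sum_nonneg fun k _ =>
      ((hf.iterate_markovFun hT hΦ k).mem_Icc x).1), ?_⟩
    rw [inv_mul_le_iff₀ (by positivity)]
    refine (Finset.sum_le_card_nsmul _ _ 1 fun k _ =>
      ((hf.iterate_markovFun hT hΦ k).mem_Icc x).2).trans ?_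
    simp

/-- Pointwise comparison at distance at most `r` is inherited along nonexpansive iterations. -/
lemma markovFun_le_markovFun [IsProbabilityMeasure μξ] {r : ℝ}
    (hf : UnitLipschitz K f) (hg : UnitLipschitz K g)
    (hT : ∀ i x y, dist (T i x) (T i y) ≤ dist x y)
    (hΦ : Measurable fun p : G × I => T p.2 p.1)
    (hfg : ∀ u v, dist u v ≤ r → f u ≤ g v) (u v : G) (huv : dist u v ≤ r) :
    markovFun μξ T f u ≤ markovFun μξ T g v :=
  integral_mono (hf.integrable_comp (measurable_apply_right hΦ u))
    (hg.integrable_comp (measurable_apply_right hΦ v))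
    fun i => hfg _ _ ((hT i u v).trans huv)

lemma cesaroFun_le_cesaroFun [IsProbabilityMeasure μξ] {r : ℝ}
    (hf : UnitLipschitz K f) (hg : UnitLipschitz K g)
    (hT : ∀ i x y, dist (T i x) (T i y) ≤ dist x y)
    (hΦ : Measurable fun p : G × I => T p.2 p.1)
    (hfg : ∀ u v, dist u v ≤ r → f u ≤ g v) (n : ℕ) {u v : G} (huv : dist u v ≤ r) :
    cesaroFun μξ T f n u ≤ cesaroFun μξ T g n v := by
  have key : ∀ k : ℕ, ∀ u v, dist u v ≤ r →
      (markovFun μξ T)^[k] f u ≤ (markovFun μξ T)^[k] g v := by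
    intro k
    induction k with
    | zero => exact hfg
    | succ k ih =>
      simp only [Function.iterate_succ_apply']
      exact markovFun_le_markovFun (hf.iterate_markovFun hT hΦ k) (hg.iterate_markovFun hT hΦ k)
        hT hΦ ih
  unfold cesaroFun
  gcongr with k
  exact key k u v huv

lemma markovFun_cesaroFun [IsProbabilityMeasure μξ] (hf : UnitLipschitz K f)
    (hT : ∀ i x y, dist (T i x) (T i y) ≤ dist x y)
    (hΦ : Measurable fun p : G × I => T p.2 p.1) (n : ℕ) (x : G) :
    markovFun μξ T (cesaroFun μξ T f n) x = cesaroFun μξ T f n x +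
      ((n : ℝ) + 1)⁻¹ * ((markovFun μξ T)^[n + 1] f x - f x) := by
  have h1 : markovFun μξ T (cesaroFun μξ T f n) x =
      ((n : ℝ) + 1)⁻¹ * ∑ k ∈ Finset.range (n + 1), (markovFun μξ T)^[k + 1] f x := by
    unfold cesaroFun
    rw [markovFun, integral_const_mul, integral_finsetSum _ fun k _ =>
      (hf.iterate_markovFun hT hΦ k).integrable_comp (measurable_apply_right hΦ x)]
    simp only [Function.iterate_succ_apply']
    rfl
  have h2 := Finset.sum_range_succ (fun k => (markovFun μξ T)^[k] f x) (n + 1)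
  rw [Finset.sum_range_succ'] at h2
  rw [h1, cesaroFun, ← mul_add]
  congr 1
  simp only [Function.iterate_zero, id] at h2
  linarith

/-- Pointwise subsequential limits of the Cesàro averages are harmonic. -/
lemma markovFun_eq_of_tendsto_cesaroFun [IsProbabilityMeasure μξ] (hf : UnitLipschitz K f)
    (hT : ∀ i x y, dist (T i x) (T i y) ≤ dist x y)
    (hΦ : Measurable fun p : G × I => T p.2 p.1) {φ : ℕ → ℕ} (hφ : StrictMono φ)
    (hh : ∀ x, Tendsto (fun n => cesaroFun μξ T f (φ n) x) atTop (𝓝 (h x))) (x : G) :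
    markovFun μξ T h x = h x := by
  have h1 : Tendsto (fun n => markovFun μξ T (cesaroFun μξ T f (φ n)) x) atTop
      (𝓝 (markovFun μξ T h x)) :=
    tendsto_integral_of_dominated_convergence (fun _ => 1)
      (fun n => ((hf.cesaroFun hT hΦ (φ n)).integrable_comp
        (measurable_apply_right hΦ x)).aestronglyMeasurable)
      (integrable_const _) (fun n => ae_of_all _ fun i => (hf.cesaroFun hT hΦ (φ n)).norm_le _)
      (ae_of_all _ fun i => hh _)
  have h2 : Tendsto (fun n : ℕ => ((n : ℝ) + 1)⁻¹ * ((markovFun μξ T)^[n + 1] f x - f x))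
      atTop (𝓝 0) := by
    refine squeeze_zero_norm (fun n => ?_) (tendsto_one_div_add_atTop_nhds_zero_nat (𝕜 := ℝ))
    rw [norm_mul, Real.norm_of_nonneg (by positivity), one_div]
    refine mul_le_of_le_one_right (by positivity) ?_
    have ha := (hf.iterate_markovFun (μξ := μξ) hT hΦ (n + 1)).mem_Icc x
    have hb := hf.mem_Icc x
    rw [Real.norm_eq_abs, abs_le]
    exact ⟨by linarith [ha.1, hb.2], by linarith [ha.2, hb.1]⟩
  have h3 := (hh x).add (h2.comp hφ.tendsto_atTop)
  rw [add_zero] at h3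
  refine tendsto_nhds_unique h1 (h3.congr fun n => ?_)
  rw [markovFun_cesaroFun hf hT hΦ]
  rfl

omit [BorelSpace G] [MetricSpace G] in
lemma measurePreserving_of_markovStep_eq [IsProbabilityMeasure μξ]
    (hΦ : Measurable fun p : G × I => T p.2 p.1) (hμ : markovStep μξ T μ = μ)
    [IsProbabilityMeasure μ] :
    MeasurePreserving (fun p : G × I => T p.2 p.1) (μ.prod μξ) μ := by
  refine ⟨hΦ, ?_⟩
  conv_rhs => rw [← hμ]
  have hker : Measurable fun x => μξ.map fun i => T i x := by
    refine Measure.measurable_of_measurable_coe _ fun s hs => ?_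
    simp_rw [Measure.map_apply (measurable_apply_right hΦ _) hs]
    exact measurable_measure_prodMk_left (hΦ hs)
  ext s hs
  rw [Measure.map_apply hΦ hs, Measure.prod_apply (hΦ hs), markovStep,
    Measure.bind_apply hs hker.aemeasurable]
  refine lintegral_congr fun x => ?_
  rw [Measure.map_apply (measurable_apply_right hΦ x) hs]
  rfl

section Invariant

variable [IsProbabilityMeasure μξ] [IsProbabilityMeasure μ]

lemma integral_markovFun (hf : UnitLipschitz K f)
    (hpres : MeasurePreserving (fun p : G × I => T p.2 p.1) (μ.prod μξ) μ) :
    ∫ x, markovFun μξ T f x ∂μ = ∫ x, f x ∂μ := by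
  unfold markovFun
  rw [← integral_prod (fun p : G × I => f (T p.2 p.1)) (hf.integrable_comp hpres.measurable)]
  conv_rhs => rw [← hpres.map_eq]
  exact (integral_map hpres.measurable.aemeasurable
    hf.lip.continuous.measurable.aestronglyMeasurable).symm

lemma integral_cesaroFun (hf : UnitLipschitz K f)
    (hT : ∀ i x y, dist (T i x) (T i y) ≤ dist x y)
    (hpres : MeasurePreserving (fun p : G × I => T p.2 p.1) (μ.prod μξ) μ) (n : ℕ) :
    ∫ x, cesaroFun μξ T f n x ∂μ = ∫ x, f x ∂μ := by
  have key : ∀ k : ℕ, ∫ x, (markovFun μξ T)^[k] f x ∂μ = ∫ x, f x ∂μ := by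
    intro k
    induction k with
    | zero => rfl
    | succ k ih =>
      rw [Function.iterate_succ_apply',
        integral_markovFun (hf.iterate_markovFun hT hpres.measurable k) hpres, ih]
  unfold cesaroFun
  rw [integral_const_mul, integral_finsetSum _ fun k _ =>
    (hf.iterate_markovFun hT hpres.measurable k).integrable]
  simp only [key, Finset.sum_const, Finset.card_range, nsmul_eq_mul]
  push_cast
  field_simp

omit [MeasurableSpace G] [BorelSpace G] [IsProbabilityMeasure μξ] in
/-- For nonexpansive maps, almost sure membership of `(x, T i x)` in a closed relation is a closed
condition on `x`. -/
lemma isClosed_setOf_ae_mem (hT : ∀ i x y, dist (T i x) (T i y) ≤ dist x y)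
    {R : Set (G × G)} (hR : IsClosed R) : IsClosed {x | ∀ᵐ i ∂μξ, (x, T i x) ∈ R} := by
  refine isClosed_of_closure_subset fun x hx => ?_
  obtain ⟨u, hu, hux⟩ := mem_closure_iff_seq_limit.1 hx
  filter_upwards [ae_all_iff.2 hu] with i hi
  have hc : Continuous (T i) := (LipschitzWith.of_dist_le_mul (K := 1)
    fun x y => by simpa using hT i x y).continuous
  exact hR.mem_of_tendsto (hux.prodMk_nhds ((hc.tendsto x).comp hux)) (.of_forall hi)

variable [TopologicalSpace.SeparableSpace G]

omit [IsProbabilityMeasure μ] [BorelSpace G] in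
/-- The support of an invariant measure is almost surely invariant. -/
lemma ae_mem_support_of_mem_support (hT : ∀ i x y, dist (T i x) (T i y) ≤ dist x y)
    (hpres : MeasurePreserving (fun p : G × I => T p.2 p.1) (μ.prod μξ) μ)
    {x : G} (hx : x ∈ μ.support) : ∀ᵐ i ∂μξ, T i x ∈ μ.support := by
  have := UniformSpace.secondCountable_of_separable G
  have h1 : ∀ᵐ p ∂μ.prod μξ, T p.2 p.1 ∈ μ.support :=
    hpres.quasiMeasurePreserving.ae (Measure.support_mem_ae (μ := μ))
  exact Measure.support_subset_of_isClosed
    (isClosed_setOf_ae_mem hT (Measure.isClosed_support.preimage continuous_snd))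
    (Measure.ae_ae_of_ae_prod h1) hx

/-- A harmonic function is almost surely invariant along one step, started in the support. -/
lemma ae_apply_eq_of_markovFun_eq (hT : ∀ i x y, dist (T i x) (T i y) ≤ dist x y)
    (hpres : MeasurePreserving (fun p : G × I => T p.2 p.1) (μ.prod μξ) μ)
    (hh : UnitLipschitz K h) (hPh : ∀ x, markovFun μξ T h x = h x)
    {x : G} (hx : x ∈ μ.support) : ∀ᵐ i ∂μξ, h (T i x) = h x := by
  have := UniformSpace.secondCountable_of_separable G
  have hm := hh.lip.continuous.measurable
  have hΦ := hpres.measurable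
  have hbd : ∀ u v : G, ‖h u * h v‖ ≤ 1 := fun u v => by
    rw [norm_mul]
    exact mul_le_one₀ (hh.norm_le u) (norm_nonneg _) (hh.norm_le v)
  have i1 : Integrable (fun p : G × I => h (T p.2 p.1) * h (T p.2 p.1)) (μ.prod μξ) :=
    .of_bound ((hm.comp hΦ).mul (hm.comp hΦ)).aestronglyMeasurable 1 (ae_of_all _ fun _ => hbd _ _)
  have i2 : Integrable (fun p : G × I => h p.1 * h (T p.2 p.1)) (μ.prod μξ) :=
    .of_bound ((hm.comp measurable_fst).mul (hm.comp hΦ)).aestronglyMeasurable 1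
      (ae_of_all _ fun _ => hbd _ _)
  have i3 : Integrable (fun p : G × I => h p.1 * h p.1) (μ.prod μξ) :=
    .of_bound ((hm.comp measurable_fst).mul (hm.comp measurable_fst)).aestronglyMeasurable 1
      (ae_of_all _ fun _ => hbd _ _)
  have e1 : ∫ p, h (T p.2 p.1) * h (T p.2 p.1) ∂(μ.prod μξ) = ∫ x, h x * h x ∂μ := by
    conv_rhs => rw [← hpres.map_eq]
    exact (integral_map hΦ.aemeasurable (hm.mul hm).aestronglyMeasurable).symm
  have e2 : ∫ p, h p.1 * h (T p.2 p.1) ∂(μ.prod μξ) = ∫ x, h x * h x ∂μ := by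
    rw [integral_prod _ i2]
    refine integral_congr_ae (ae_of_all _ fun x => ?_)
    dsimp only
    rw [integral_const_mul]
    exact congrArg (h x * ·) (hPh x)
  have e3 : ∫ p, h p.1 * h p.1 ∂(μ.prod μξ) = ∫ x, h x * h x ∂μ := by
    rw [integral_prod _ i3]
    simp
  have hsq : ∀ p : G × I, (h (T p.2 p.1) - h p.1) ^ 2 =
      h (T p.2 p.1) * h (T p.2 p.1) - (2 * (h p.1 * h (T p.2 p.1)) - h p.1 * h p.1) :=
    fun p => by ring
  have i4 : Integrable (fun p : G × I => (h (T p.2 p.1) - h p.1) ^ 2) (μ.prod μξ) := by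
    simp_rw [hsq]
    exact i1.sub ((i2.const_mul 2).sub i3)
  have e4 : ∫ p, (h (T p.2 p.1) - h p.1) ^ 2 ∂(μ.prod μξ) = 0 := by
    simp_rw [hsq]
    have i23 : Integrable (fun p : G × I => 2 * (h p.1 * h (T p.2 p.1)) - h p.1 * h p.1)
        (μ.prod μξ) := (i2.const_mul 2).sub i3
    rw [integral_sub i1 i23, integral_sub (i2.const_mul 2) i3,
      integral_const_mul, e1, e2, e3]
    ring
  have hae : ∀ᵐ p ∂(μ.prod μξ), h (T p.2 p.1) = h p.1 := by
    filter_upwards [(integral_eq_zero_iff_of_nonneg (fun _ => sq_nonneg _) i4).1 e4] with p hp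
    exact sub_eq_zero.1 (pow_eq_zero_iff two_ne_zero |>.1 hp)
  have hcl : IsClosed {p : G × G | h p.2 = h p.1} :=
    isClosed_eq (hh.lip.continuous.comp continuous_snd) (hh.lip.continuous.comp continuous_fst)
  exact Measure.support_subset_of_isClosed (isClosed_setOf_ae_mem hT hcl)
    (Measure.ae_ae_of_ae_prod hae) hx

omit [BorelSpace G] [IsProbabilityMeasure μ] [TopologicalSpace.SeparableSpace G]
  [MetricSpace G] in
lemma IsErgodicInv.measure_eq_zero_or_one (hμ : IsErgodicInv μξ T μ)
    (hΦ : Measurable fun p : G × I => T p.2 p.1) {A : Set G} (hA : MeasurableSet A)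
    (h : ∀ x ∈ A, ∀ᵐ i ∂μξ, T i x ∈ A) : μ A = 0 ∨ μ A = 1 := by
  refine hμ.2.2 A hA fun x hx => ?_
  rw [Measure.map_apply (measurable_apply_right hΦ x) hA]
  exact (mem_ae_iff_prob_eq_one (measurable_apply_right hΦ x hA)).1 (h x hx)

omit [TopologicalSpace.SeparableSpace G] in
/-- A closed almost surely invariant set charged by an ergodic measure contains its support. -/
lemma IsErgodicInv.support_subset (hμ : IsErgodicInv μξ T μ)
    (hΦ : Measurable fun p : G × I => T p.2 p.1) {A : Set G} (hA : IsClosed A)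
    (h : ∀ x ∈ A, ∀ᵐ i ∂μξ, T i x ∈ A) (h0 : μ A ≠ 0) : μ.support ⊆ A :=
  Measure.support_subset_of_isClosed hA <| (mem_ae_iff_prob_eq_one hA.measurableSet).2 <|
    (hμ.measure_eq_zero_or_one hΦ hA.measurableSet h).resolve_left h0

lemma IsErgodicInv.eq_integral_of_markovFun_eq (hμ : IsErgodicInv μξ T μ)
    (hT : ∀ i x y, dist (T i x) (T i y) ≤ dist x y)
    (hΦ : Measurable fun p : G × I => T p.2 p.1)
    (hh : UnitLipschitz K h) (hPh : ∀ x, markovFun μξ T h x = h x)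
    {x : G} (hx : x ∈ μ.support) : h x = ∫ y, h y ∂μ := by
  have := UniformSpace.secondCountable_of_separable G
  have hpres := measurePreserving_of_markovStep_eq hΦ hμ.2.1
  have hle : ∀ u ∈ μ.support, ∀ v ∈ μ.support, h v ≤ h u := by
    intro u hu v hv
    refine le_of_forall_gt_imp_ge_of_dense fun c hc => ?_
    have hcl : IsClosed (μ.support ∩ {z | h z ≤ c}) :=
      Measure.isClosed_support.inter (isClosed_le hh.lip.continuous continuous_const)
    refine (hμ.support_subset hΦ hcl (fun z hz => ?_) ?_ hv).2
    · filter_upwards [ae_mem_support_of_mem_support hT hpres hz.1,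
        ae_apply_eq_of_markovFun_eq hT hpres hh hPh hz.1] with i hi1 hi2
      exact ⟨hi1, hi2.le.trans hz.2⟩
    · have hpos : 0 < μ {z | h z ≤ c} := (Measure.mem_support_iff_forall u).1 hu _
        (mem_of_superset ((isOpen_lt hh.lip.continuous continuous_const).mem_nhds hc)
          fun z (hz : h z < c) => hz.le)
      rw [Set.inter_comm, measure_inter_conull Measure.measure_compl_support]
      exact hpos.ne'
  calc h x = ∫ _, h x ∂μ := by simp
    _ = ∫ y, h y ∂μ := by
      refine integral_congr_ae ?_
      filter_upwards [Measure.support_mem_ae (μ := μ)] with y hy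
      exact le_antisymm (hle y hy x hx) (hle x hx y hy)

/-- Subsequential limits of Cesàro averages equal the space average on the support. -/
lemma IsErgodicInv.eq_integral_of_tendsto_cesaroFun (hμ : IsErgodicInv μξ T μ)
    (hT : ∀ i x y, dist (T i x) (T i y) ≤ dist x y)
    (hΦ : Measurable fun p : G × I => T p.2 p.1)
    (hf : UnitLipschitz K f) {φ : ℕ → ℕ} (hφ : StrictMono φ)
    (hh : ∀ x, Tendsto (fun n => cesaroFun μξ T f (φ n) x) atTop (𝓝 (h x)))
    {x : G} (hx : x ∈ μ.support) : h x = ∫ y, f y ∂μ := by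
  have hpres := measurePreserving_of_markovStep_eq hΦ hμ.2.1
  have hces := fun n => hf.cesaroFun (μξ := μξ) hT hΦ (φ n)
  rw [hμ.eq_integral_of_markovFun_eq hT hΦ (UnitLipschitz.of_tendsto hces hh)
    (markovFun_eq_of_tendsto_cesaroFun hf hT hΦ hφ hh) hx]
  have h1 : Tendsto (fun n => ∫ y, cesaroFun μξ T f (φ n) y ∂μ) atTop (𝓝 (∫ y, h y ∂μ)) :=
    tendsto_integral_of_dominated_convergence (fun _ => 1)
      (fun n => (hces n).integrable.aestronglyMeasurable)
      (integrable_const _) (fun n => ae_of_all _ (hces n).norm_le) (ae_of_all _ hh)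
  simp_rw [integral_cesaroFun hf hT hpres] at h1
  exact tendsto_nhds_unique h1 tendsto_const_nhds

end Invariant

section TwoMeasures

variable [IsProbabilityMeasure μξ] [TopologicalSpace.SeparableSpace G]
  {μ ν : Measure G} [IsProbabilityMeasure μ] [IsProbabilityMeasure ν]

lemma IsErgodicInv.integral_le_integral (hμ : IsErgodicInv μξ T μ) (hν : IsErgodicInv μξ T ν)
    (hT : ∀ i x y, dist (T i x) (T i y) ≤ dist x y)
    (hΦ : Measurable fun p : G × I => T p.2 p.1)
    (hf : UnitLipschitz K f) (hg : UnitLipschitz K g) {r : ℝ}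
    (hfg : ∀ u v, dist u v ≤ r → f u ≤ g v) {x y : G} (hx : x ∈ μ.support) (hy : y ∈ ν.support)
    (hxy : dist x y ≤ r) : ∫ z, f z ∂μ ≤ ∫ z, g z ∂ν := by
  obtain ⟨φ, F, hφ, hF⟩ := UnitLipschitz.exists_tendsto_subseq (hf.cesaroFun (μξ := μξ) hT hΦ)
  obtain ⟨ψ, H, hψ, hH⟩ := UnitLipschitz.exists_tendsto_subseq
    fun n => hg.cesaroFun (μξ := μξ) hT hΦ (φ n)
  have hF' : ∀ z, Tendsto (fun n => cesaroFun μξ T f ((φ ∘ ψ) n) z) atTop (𝓝 (F z)) :=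
    fun z => (hF z).comp hψ.tendsto_atTop
  rw [← hμ.eq_integral_of_tendsto_cesaroFun hT hΦ hf (hφ.comp hψ) hF' hx,
    ← hν.eq_integral_of_tendsto_cesaroFun hT hΦ hg (hφ.comp hψ) hH hy]
  exact le_of_tendsto_of_tendsto' (hF' x) (hH y) fun n =>
    cesaroFun_le_cesaroFun hf hg hT hΦ hfg _ hxy

omit [MeasurableSpace G] [BorelSpace G] [TopologicalSpace.SeparableSpace G] in
lemma unitLipschitz_max_infDist (B : Set G) (r : ℝ) {δ : ℝ} (hδ : 0 < δ) :
    UnitLipschitz (Real.toNNReal δ⁻¹)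
      fun u => max 0 (1 - max 0 (Metric.infDist u B - r) / δ) where
  lip := by
    refine LipschitzWith.of_dist_le_mul fun x y => ?_
    rw [Real.coe_toNNReal _ (by positivity), Real.dist_eq]
    have hd : |Metric.infDist x B - Metric.infDist y B| ≤ dist x y := by
      simpa [Real.dist_eq] using (Metric.lipschitz_infDist_pt B).dist_le_mul x y
    have hmax : ∀ a b : ℝ, |max 0 a - max 0 b| ≤ |a - b| := fun a b => by
      rw [max_comm 0 a, max_comm 0 b]
      exact abs_max_sub_max_le_abs a b 0
    have hδ' : 0 ≤ δ⁻¹ := inv_nonneg.2 hδ.le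
    calc _ ≤ |(1 - max 0 (Metric.infDist x B - r) / δ) - (1 - max 0 (Metric.infDist y B - r) / δ)| :=
          hmax _ _
      _ = δ⁻¹ * |max 0 (Metric.infDist x B - r) - max 0 (Metric.infDist y B - r)| := by
          rw [sub_sub_sub_cancel_left, abs_sub_comm, ← sub_div, abs_div, abs_of_pos hδ,
            div_eq_inv_mul]
      _ ≤ δ⁻¹ * |(Metric.infDist x B - r) - (Metric.infDist y B - r)| :=
          mul_le_mul_of_nonneg_left (hmax _ _) hδ'
      _ ≤ δ⁻¹ * dist x y := by
          rw [sub_sub_sub_cancel_right]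
          exact mul_le_mul_of_nonneg_left hd hδ'
  mem_Icc u := by
    refine ⟨le_max_left _ _, max_le zero_le_one ?_⟩
    have : 0 ≤ max 0 (Metric.infDist u B - r) / δ := div_nonneg (le_max_left _ _) hδ.le
    linarith

/-- If the supports of two ergodic measures contain points at distance at most `r`, then the
measures are comparable with arbitrarily small error beyond thickening by `r`. -/
lemma IsErgodicInv.measure_le_measure_thickening (hμ : IsErgodicInv μξ T μ)
    (hν : IsErgodicInv μξ T ν) (hT : ∀ i x y, dist (T i x) (T i y) ≤ dist x y)
    (hΦ : Measurable fun p : G × I => T p.2 p.1) {x y : G} (hx : x ∈ μ.support)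
    (hy : y ∈ ν.support) {r δ : ℝ} (hxy : dist x y ≤ r) (hδ : 0 < δ) {B : Set G}
    (hB : MeasurableSet B) : μ B ≤ ν (Metric.thickening (r + δ) B) := by
  rcases B.eq_empty_or_nonempty with rfl | hne
  · simp
  have hf := unitLipschitz_max_infDist B 0 hδ
  have hg := unitLipschitz_max_infDist B r hδ
  have hle := hμ.integral_le_integral hν hT hΦ hf hg (r := r) (fun u v huv => by
    have := Metric.infDist_le_infDist_add_dist (s := B) (x := v) (y := u)
    rw [dist_comm] at this
    gcongr max 0 (1 - max 0 ?_ / δ)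
    linarith) hx hy hxy
  have hl : μ.real B ≤ ∫ z, max 0 (1 - max 0 (Metric.infDist z B - 0) / δ) ∂μ := by
    rw [← integral_indicator_one hB]
    refine integral_mono ((integrable_const 1).indicator hB) hf.integrable fun z => ?_
    by_cases hz : z ∈ B
    · simp [hz, Metric.infDist_zero_of_mem hz]
    · simp [hz]
  have ht : MeasurableSet (Metric.thickening (r + δ) B) := Metric.isOpen_thickening.measurableSet
  have hu : ∫ z, max 0 (1 - max 0 (Metric.infDist z B - r) / δ) ∂ν ≤
      ν.real (Metric.thickening (r + δ) B) := by
    rw [← integral_indicator_one ht]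
    refine integral_mono hg.integrable ((integrable_const 1).indicator ht) fun z => ?_
    by_cases hz : z ∈ Metric.thickening (r + δ) B
    · rw [Set.indicator_of_mem hz]
      exact (hg.mem_Icc z).2
    · rw [Set.indicator_of_notMem hz]
      rw [Metric.mem_thickening_iff_infDist_lt hne, not_lt] at hz
      refine max_le le_rfl ?_
      rw [sub_nonpos, one_le_div hδ]
      exact le_max_of_le_right (by linarith)
  have := (hl.trans hle).trans hu
  rwa [measureReal_def, measureReal_def,
    ENNReal.toReal_le_toReal (measure_ne_top _ _) (measure_ne_top _ _)] at this

/-- If `ν` charges a closed thickening of `Supp μ`, then the thickening contains `Supp ν`. -/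
lemma IsErgodicInv.support_subset_cthickening (hμ : IsErgodicInv μξ T μ)
    (hν : IsErgodicInv μξ T ν) (hT : ∀ i x y, dist (T i x) (T i y) ≤ dist x y)
    (hΦ : Measurable fun p : G × I => T p.2 p.1) {r : ℝ}
    (h0 : ν (Metric.cthickening r μ.support) ≠ 0) :
    ν.support ⊆ Metric.cthickening r μ.support := by
  have hpres := measurePreserving_of_markovStep_eq hΦ hμ.2.1
  refine hν.support_subset hΦ Metric.isClosed_cthickening (fun y hy => ?_) h0
  have hex : ∀ n : ℕ, ∃ s ∈ μ.support, edist y s < ENNReal.ofReal r + ((n : ENNReal) + 1)⁻¹ := by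
    intro n
    refine Metric.infEDist_lt_iff.1 (lt_of_le_of_lt (Metric.mem_cthickening_iff.1 hy) ?_)
    exact ENNReal.lt_add_right ENNReal.ofReal_ne_top (by simp)
  choose s hs hys using hex
  filter_upwards [ae_all_iff.2 fun n => ae_mem_support_of_mem_support hT hpres (hs n)] with i hi
  rw [Metric.mem_cthickening_iff]
  have hlim : Tendsto (fun n : ℕ => ENNReal.ofReal r + ((n : ENNReal) + 1)⁻¹) atTop
      (𝓝 (ENNReal.ofReal r + 0)) := by
    refine tendsto_const_nhds.add ?_
    simpa using (tendsto_add_atTop_iff_nat 1).2 ENNReal.tendsto_inv_nat_nhds_zero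
  rw [add_zero] at hlim
  refine ge_of_tendsto' hlim fun n => ?_
  calc Metric.infEDist (T i y) μ.support ≤ edist (T i y) (T i (s n)) :=
        Metric.infEDist_le_edist_of_mem (hi n)
    _ ≤ edist y (s n) := by
        rw [edist_dist, edist_dist]
        exact ENNReal.ofReal_le_ofReal (hT i _ _)
    _ ≤ _ := (hys n).le

end TwoMeasures

end RandomIteration

/-- characterization of balls of ergodic measures in the
Prokhorov–Lévy metric: `G` Polish, each `T i` nonexpansive, `π, π̃` ergodic invariant
probability measures, `ε ∈ (0,1)`.  Then `d_P(π, π̃) ≤ ε` iff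
`Supp π̃ ⊆ B̄(Supp π, ε)`. -/
theorem stmt17
    {G I : Type*} [MetricSpace G] [TopologicalSpace.SeparableSpace G] [CompleteSpace G]
    [MeasurableSpace G] [BorelSpace G] [MeasurableSpace I]
    (T : I → G → G) (hT : ∀ i x y, dist (T i x) (T i y) ≤ dist x y)
    (hΦ : Measurable fun p : G × I => T p.2 p.1)
    (μξ : Measure I) [IsProbabilityMeasure μξ]
    (π π' : Measure G) (hπ : IsErgodicInv μξ T π) (hπ' : IsErgodicInv μξ T π')
    (ε : ℝ) (hε0 : 0 < ε) (hε1 : ε < 1) :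
    levyProkhorovDist π π' ≤ ε ↔ msupport π' ⊆ Metric.cthickening ε (msupport π) := by
  have := hπ.1
  have := hπ'.1
  have := UniformSpace.secondCountable_of_separable G
  rw [msupport_eq_support, msupport_eq_support, levyProkhorovDist]
  have hone : π π.support = 1 :=
    (mem_ae_iff_prob_eq_one Measure.isClosed_support.measurableSet).1 Measure.support_mem_ae
  constructor
  · intro hd
    rw [Metric.cthickening_eq_iInter_cthickening' (Set.Ioo ε 1) (fun _ h => h.1)
      fun c hc => by
        obtain ⟨d, hd1, hd2⟩ := exists_between (lt_min hc hε1)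
        exact ⟨d, ⟨hd1, hd2.trans_le (min_le_right _ _)⟩, hd1, (hd2.trans_le (min_le_left _ _)).le⟩]
    refine Set.subset_iInter₂ fun c hc => ?_
    have hc0 : 0 < c := hε0.trans hc.1
    have hlt : levyProkhorovEDist π π' < ENNReal.ofReal c := by
      rw [ENNReal.lt_ofReal_iff_toReal_lt (levyProkhorovEDist_ne_top _ _)]
      exact hd.trans_lt hc.1
    have hm := left_measure_le_of_levyProkhorovEDist_lt hlt
      (Measure.isClosed_support (μ := π)).measurableSet
    rw [ENNReal.toReal_ofReal hc0.le, hone] at hm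
    refine hπ.support_subset_cthickening hπ' hT hΦ fun h0 => ?_
    rw [measure_mono_null (Metric.thickening_subset_cthickening c _) h0, zero_add] at hm
    exact absurd hm (not_le.2 (by rw [ENNReal.ofReal_lt_one]; exact hc.2))
  · intro hsub
    refine ENNReal.toReal_le_of_le_ofReal hε0.le (levyProkhorovEDist_le_of_forall_le _ _ _
      fun c B hc hc_top hB => ?_)
    obtain ⟨y, hy⟩ : π'.support.Nonempty :=
      nonempty_of_mem (Measure.support_mem_ae (μ := π'))
    have hεc : ε < c.toReal := (ENNReal.ofReal_lt_iff_lt_toReal hε0.le hc_top.ne).1 hc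
    obtain ⟨r, hr1, hr2⟩ := exists_between hεc
    obtain ⟨x, hx, hyx⟩ := Metric.mem_thickening_iff.1
      (Metric.cthickening_subset_thickening' (hε0.trans hr1) hr1 _ (hsub hy))
    have hle := hπ.measure_le_measure_thickening hπ' hT hΦ hx hy
      ((dist_comm x y).trans_le hyx.le) (sub_pos.2 hr2) hB
    rw [add_sub_cancel] at hle
    exact hle.trans le_self_add
end
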